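/- Let M ⊆ ℝ^m be a domain, f : ℝ≥0 × M × ℝ^m → ℝ^m C²-smooth, F ∈ C⁴(M), c ∈ ℝ, with the closure of D_c compact and contained in M, and suppose the transversality condition holds: for every (t, x) ∈ ℝ≥0 × ∂D_c and every ξ ∈ ℝ^m, dF(x)[ξ] = 0 implies dF(x)[f(t,x,ξ)] + d²F(x)[ξ,ξ] > 0. Let v : M → ℝ^m be a continuous vector field with dF(x)[v(x)] ≥ 0 for all x ∈ ∂D_c, and for y ∈ D_c let x(t, y) denote the solution of ẍ = f(t, x, ẋ) with x(0, y) = y, ẋ(0, y) = v(y). Assume every such solution leaves D_c, let τ(y) > 0 be the first time at which F(x(τ(y), y)) = c, and set τ(y) = 0 for y ∈ ∂D_c. Then the extended function τ is continuous on the closure of D_c; in particular, τ(y) → 0 as y ∈ D_c tends to any boundary point ỹ ∈ ∂D_c. -/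

import Mathlib

open Set

noncomputable section

/-- `x, x'` form a solution of the second-order system `ẍ = f(t, x, ẋ)` on the
time set `s`, with the curve staying in the domain `M`. -/
def IsSolOn {m : ℕ} (M : Set (EuclideanSpace ℝ (Fin m)))
    (f : ℝ → EuclideanSpace ℝ (Fin m) → EuclideanSpace ℝ (Fin m) → EuclideanSpace ℝ (Fin m))
    (x x' : ℝ → EuclideanSpace ℝ (Fin m)) (s : Set ℝ) : Prop :=
  ∀ t ∈ s, x t ∈ M ∧ HasDerivWithinAt x (x' t) s t ∧
    HasDerivWithinAt x' (f t (x t) (x' t)) s t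

section Trajectories

open Filter Topology

variable {P : Type*} [NormedAddCommGroup P] [NormedSpace ℝ P]

/-- `z` solves the first-order equation `ż = V (t, z)` for all `t ≥ 0` while staying in `Ω`. -/
def IsTrajectory (Ω : Set P) (V : ℝ × P → P) (z : ℝ → P) : Prop :=
  ∀ t, 0 ≤ t → z t ∈ Ω ∧ HasDerivWithinAt z (V (t, z t)) (Ici 0) t

theorem IsTrajectory.continuousOn {Ω : Set P} {V : ℝ × P → P} {z : ℝ → P}
    (hz : IsTrajectory Ω V z) : ContinuousOn z (Ici 0) :=
  fun t ht => (hz t ht).2.continuousWithinAt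

theorem IsTrajectory.hasDerivWithinAt_Ici {Ω : Set P} {V : ℝ × P → P} {z : ℝ → P}
    (hz : IsTrajectory Ω V z) {t : ℝ} (ht : 0 ≤ t) :
    HasDerivWithinAt z (V (t, z t)) (Ici t) t :=
  (hz t ht).2.mono (Ici_subset_Ici.2 ht)

/-- A `C¹` function on `[0, ∞) × Ω`, with `Ω` open, is locally Lipschitz there. -/
theorem ContDiffOn.locallyLipschitzOn_Ici_prod {Q : Type*} [NormedAddCommGroup Q]
    [NormedSpace ℝ Q] {Ω : Set P} (hΩ : IsOpen Ω) {V : ℝ × P → Q}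
    (hV : ContDiffOn ℝ 1 V (Ici 0 ×ˢ Ω)) : LocallyLipschitzOn (Ici 0 ×ˢ Ω) V := by
  rintro ⟨t, p⟩ ⟨ht, hp⟩
  obtain ⟨r, hr, hball⟩ := Metric.isOpen_iff.1 hΩ p hp
  have hsub : Ici (0 : ℝ) ×ˢ Metric.ball p r ⊆ Ici 0 ×ˢ Ω := prod_mono subset_rfl hball
  obtain ⟨K, s, hs, hK⟩ := ContDiffWithinAt.exists_lipschitzOnWith
    ((hV (t, p) ⟨ht, hp⟩).mono hsub) ((convex_Ici 0).prod (convex_ball p r))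
  refine ⟨K, s, ?_, hK⟩
  have heq : 𝓝[Ici (0 : ℝ) ×ˢ Ω] (t, p) = 𝓝[Ici (0 : ℝ) ×ˢ Metric.ball p r] (t, p) := by
    rw [nhdsWithin_prod_eq, nhdsWithin_prod_eq, hΩ.nhdsWithin_eq hp,
      Metric.isOpen_ball.nhdsWithin_eq (Metric.mem_ball_self hr)]
  rwa [heq]

/-- Continuous dependence on initial data, uniformly on compact time intervals. -/
theorem IsTrajectory.exists_forall_norm_sub_le [ProperSpace P] {Ω : Set P} (hΩ : IsOpen Ω)
    {V : ℝ × P → P} (hV : LocallyLipschitzOn (Ici 0 ×ˢ Ω) V) {γ : ℝ → P}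
    (hγ : IsTrajectory Ω V γ) (T : ℝ) {ε : ℝ} (hε : 0 < ε) :
    ∃ δ > 0, ∀ z : ℝ → P, IsTrajectory Ω V z → ‖z 0 - γ 0‖ ≤ δ →
      ∀ t ∈ Icc 0 T, ‖z t - γ t‖ ≤ ε := by
  have hcomp : IsCompact (γ '' Icc 0 T) :=
    isCompact_Icc.image_of_continuousOn (hγ.continuousOn.mono Icc_subset_Ici_self)
  obtain ⟨r, hr, hrΩ⟩ := hcomp.exists_cthickening_subset_open hΩ
    (by rintro _ ⟨t, ht, rfl⟩; exact (hγ t ht.1).1)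
  obtain ⟨K, hK⟩ := (hV.mono (prod_mono Icc_subset_Ici_self hrΩ)).exists_lipschitzOnWith_of_compact
    ((isCompact_Icc (a := (0 : ℝ)) (b := T)).prod (hcomp.cthickening (r := r)))
  have hL : (0 : ℝ) < K + 1 := by positivity
  have hmin : 0 < min ε r := lt_min hε hr
  refine ⟨min ε r * Real.exp (-((K + 1) * T)), by positivity, fun z hz h0 => ?_⟩
  set δ := min ε r * Real.exp (-((K + 1) * T)) with hδ
  have hδpos : 0 < δ := by positivity
  have hB : ∀ t ∈ Icc 0 T, δ * Real.exp ((K + 1) * t) ≤ min ε r := by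
    intro t ht
    rw [hδ, mul_assoc, ← Real.exp_add]
    have : Real.exp (-((K + 1) * T) + (K + 1) * t) ≤ 1 := by
      rw [Real.exp_le_one_iff]
      have := mul_le_mul_of_nonneg_left ht.2 hL.le
      linarith
    nlinarith
  have key := image_norm_le_of_norm_deriv_right_lt_deriv_boundary (a := 0) (b := T)
    (f := fun t => z t - γ t) (f' := fun t => V (t, z t) - V (t, γ t))
    (B := fun t => δ * Real.exp ((K + 1) * t))
    (B' := fun t => δ * (Real.exp ((K + 1) * t) * (K + 1)))
    ((hz.continuousOn.sub hγ.continuousOn).mono Icc_subset_Ici_self)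
    (fun t ht => (hz.hasDerivWithinAt_Ici ht.1).sub (hγ.hasDerivWithinAt_Ici ht.1))
    (by simpa using h0)
    (fun t => by
      have := (((hasDerivAt_id t).const_mul ((K : ℝ) + 1)).exp).const_mul δ
      simpa using this)
    (fun t ht hnorm => by
      have htI : t ∈ Icc 0 T := Ico_subset_Icc_self ht
      have hmem : γ t ∈ γ '' Icc 0 T := mem_image_of_mem _ htI
      have hzmem : z t ∈ Metric.cthickening r (γ '' Icc 0 T) := by
        refine Metric.closedBall_subset_cthickening hmem r ?_
        rw [mem_closedBall_iff_norm, hnorm]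
        exact (hB t htI).trans (min_le_right _ _)
      have hlip := hK.dist_le_mul (t, z t) ⟨htI, hzmem⟩ (t, γ t)
        ⟨htI, Metric.self_subset_cthickening _ hmem⟩
      rw [dist_eq_norm, dist_prod_same_left, dist_eq_norm, hnorm] at hlip
      have : 0 < δ * Real.exp ((K + 1) * t) := by positivity
      nlinarith)
  exact fun t ht => (key ht).trans ((hB t ht).trans (min_le_left _ _))

/-- Trajectories starting close to `p` stay close to `p` for a uniform positive time. -/
theorem IsTrajectory.exists_forall_norm_sub_le_of_initial {Ω : Set P}
    {V : ℝ × P → P} (hV : ContinuousOn V (Ici 0 ×ˢ Ω)) {p : P} (hp : p ∈ Ω)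
    {ε : ℝ} (hε : 0 < ε) :
    ∃ δ > 0, ∃ η > 0, ∀ z : ℝ → P, IsTrajectory Ω V z → ‖z 0 - p‖ ≤ δ →
      ∀ t ∈ Icc 0 η, ‖z t - p‖ ≤ ε := by
  have hcont : Tendsto (fun q => ‖V q‖) (𝓝[Ici 0 ×ˢ Ω] ((0 : ℝ), p)) (𝓝 ‖V (0, p)‖) :=
    (hV (0, p) ⟨self_mem_Ici, hp⟩).norm
  set K := ‖V (0, p)‖ + 1 with hKdef
  have hK0 : 0 < K := by positivity
  have hev := hcont.eventually_lt_const (lt_add_one ‖V (0, p)‖)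
  obtain ⟨r, hr, hball⟩ := Metric.mem_nhdsWithin_iff.1 hev
  set ρ := min ε (r / 2) with hρ
  have hρ0 : 0 < ρ := lt_min hε (by positivity)
  refine ⟨ρ / 2, by positivity, min (r / 2) (ρ / (2 * K)), by positivity, fun z hz h0 => ?_⟩
  set η := min (r / 2) (ρ / (2 * K)) with hη
  have hB : ∀ t ∈ Icc 0 η, ρ / 2 + K * t ≤ ρ := by
    intro t ht
    have h1 : t ≤ ρ / (2 * K) := ht.2.trans (min_le_right _ _)
    rw [le_div_iff₀ (by positivity)] at h1
    linarith
  have key := image_norm_le_of_norm_deriv_right_lt_deriv_boundary (a := 0) (b := η)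
    (f := fun t => z t - p) (f' := fun t => V (t, z t))
    (B := fun t => ρ / 2 + K * t) (B' := fun _ => K)
    ((hz.continuousOn.sub continuousOn_const).mono Icc_subset_Ici_self)
    (fun t ht => (hz.hasDerivWithinAt_Ici ht.1).sub_const p)
    (by simpa using h0)
    (fun t => by simpa using ((hasDerivAt_id t).const_mul K).const_add (ρ / 2))
    (fun t ht hnorm => by
      have htI : t ∈ Icc 0 η := Ico_subset_Icc_self ht
      refine hball ⟨?_, ht.1, (hz t ht.1).1⟩
      rw [Metric.mem_ball, Prod.dist_eq, max_lt_iff]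
      constructor
      · have : t ≤ r / 2 := htI.2.trans (min_le_left _ _)
        rw [Real.dist_eq, sub_zero, abs_of_nonneg ht.1]
        linarith
      · have : ρ ≤ r / 2 := min_le_right _ _
        have h3 := hB t htI
        change dist (z t) p < r
        rw [dist_eq_norm, hnorm]
        linarith)
  exact fun t ht => (key ht).trans ((hB t ht).trans (min_le_left _ _))

end Trajectories

section RealFunctions

open Filter Topology

/-- At the first time a function reaches the level `c` from below, its derivative is positive,
provided that its second derivative is positive whenever the first one vanishes. -/
theorem deriv_pos_of_first_hit {g h : ℝ → ℝ} {τ c k : ℝ} (hτ : 0 < τ)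
    (hg : ∀ t, 0 ≤ t → HasDerivWithinAt g (h t) (Ici 0) t)
    (hh : HasDerivWithinAt h k (Ici 0) τ) (hlt : ∀ t ∈ Ico 0 τ, g t < c) (hc : g τ = c)
    (hk : h τ = 0 → 0 < k) : 0 < h τ := by
  by_contra! hle
  have hh' : HasDerivAt h k τ := hh.hasDerivAt (Ici_mem_nhds hτ)
  have hneg : ∀ᶠ t in 𝓝[<] τ, h t < 0 := by
    rcases hle.lt_or_eq with h0 | h0
    · exact (hh'.continuousAt.eventually_lt_const h0).filter_mono nhdsWithin_le_nhds
    · have hs := (hasDerivAt_iff_tendsto_slope_left_right.1 hh').1.eventually_const_lt (hk h0)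
      filter_upwards [hs, self_mem_nhdsWithin] with t ht (htτ : t < τ)
      rw [slope_def_field, h0, sub_zero] at ht
      by_contra! h1
      exact ht.not_ge (div_nonpos_of_nonneg_of_nonpos h1 (sub_nonpos.2 htτ.le))
  obtain ⟨l, hl, hlτ⟩ := (mem_nhdsLT_iff_exists_Ioo_subset' hτ).1
    (hneg.and (Ioo_mem_nhdsLT hτ))
  obtain ⟨a, hla, haτ⟩ := exists_between (show l < τ from hl)
  have ha0 : 0 < a := (hlτ ⟨hla, haτ⟩).2.1
  have hanti : AntitoneOn g (Icc a τ) := by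
    have hd : ∀ t ∈ interior (Icc a τ), HasDerivAt g (h t) t := fun t ht => by
      rw [interior_Icc] at ht
      have : 0 < t := ha0.trans ht.1
      exact (hg t this.le).hasDerivAt (Ici_mem_nhds this)
    refine antitoneOn_of_deriv_nonpos (convex_Icc _ _)
      (fun t ht => ((hg t (ha0.le.trans ht.1)).continuousWithinAt).mono
        fun s hs => ha0.le.trans hs.1)
      (fun t ht => (hd t ht).differentiableAt.differentiableWithinAt) fun t ht => ?_
    rw [(hd t ht).deriv]
    rw [interior_Icc] at ht
    exact (hlτ ⟨hla.trans ht.1, ht.2⟩).1.le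
  have := hanti (left_mem_Icc.2 haτ.le) (right_mem_Icc.2 haτ.le) haτ.le
  have := hlt a ⟨ha0.le, haτ⟩
  linarith

/-- A function with positive derivative at `τ` exceeds `g τ` at times arbitrarily close to `τ`
on the right. -/
theorem exists_gt_of_hasDerivAt_pos {g : ℝ → ℝ} {τ d : ℝ} (hg : HasDerivAt g d τ) (hd : 0 < d)
    {ε : ℝ} (hε : 0 < ε) : ∃ t ∈ Ioo τ (τ + ε), g τ < g t := by
  have hs := (hasDerivAt_iff_tendsto_slope_left_right.1 hg).2.eventually_const_lt hd
  obtain ⟨t, ht, htI⟩ := (hs.and (Ioo_mem_nhdsGT (lt_add_of_pos_right τ hε))).exists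
  refine ⟨t, htI, ?_⟩
  rw [slope_def_field] at ht
  have := (div_pos_iff_of_pos_right (sub_pos.2 htI.1)).1 ht
  linarith

/-- Linear lower bound from a lower bound on the derivative. -/
theorem add_mul_le_of_deriv_ge {g h : ℝ → ℝ} {a η : ℝ}
    (hg : ∀ t, 0 ≤ t → HasDerivWithinAt g (h t) (Ici 0) t) (ha : ∀ t ∈ Icc 0 η, a ≤ h t) :
    ∀ t ∈ Icc 0 η, g 0 + a * t ≤ g t := by
  have key := image_le_of_deriv_right_le_deriv_boundary (a := 0) (b := η)
    (f := fun t => g 0 + a * t) (f' := fun _ => a) (B := g) (B' := h)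
    (by fun_prop)
    (fun t _ => by
      simpa using (((hasDerivAt_id t).const_mul a).const_add (g 0)).hasDerivWithinAt)
    (by simp) (fun t ht => (hg t ht.1).continuousWithinAt.mono Icc_subset_Ici_self)
    (fun t ht => (hg t ht.1).mono (Ici_subset_Ici.2 ht.1))
    (fun t ht => ha t (Ico_subset_Icc_self ht))
  exact fun t ht => key ht

/-- Quadratic lower bound from a lower bound on the second derivative. -/
theorem add_mul_add_sq_le_of_second_deriv_ge {g h k : ℝ → ℝ} {a η : ℝ}
    (hg : ∀ t, 0 ≤ t → HasDerivWithinAt g (h t) (Ici 0) t)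
    (hh : ∀ t, 0 ≤ t → HasDerivWithinAt h (k t) (Ici 0) t) (ha : ∀ t ∈ Icc 0 η, a ≤ k t) :
    ∀ t ∈ Icc 0 η, g 0 + h 0 * t + a / 2 * t ^ 2 ≤ g t := by
  have key := image_le_of_deriv_right_le_deriv_boundary (a := 0) (b := η)
    (f := fun t => g 0 + h 0 * t + a / 2 * t ^ 2) (f' := fun t => h 0 + a * t) (B := g) (B' := h)
    (by fun_prop)
    (fun t _ => by
      have := ((((hasDerivAt_id t).const_mul (h 0)).const_add (g 0)).add
        (((hasDerivAt_id t).pow 2).const_mul (a / 2))).hasDerivWithinAt (s := Ici t)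
      exact this.congr_deriv (by simp; ring))
    (by simp) (fun t ht => (hg t ht.1).continuousWithinAt.mono Icc_subset_Ici_self)
    (fun t ht => (hg t ht.1).mono (Ici_subset_Ici.2 ht.1))
    (fun t ht => add_mul_le_of_deriv_ge hh ha t (Ico_subset_Icc_self ht))
  exact fun t ht => key ht

end RealFunctions

section SecondOrder

open Filter Topology

variable {m : ℕ} {M : Set (EuclideanSpace ℝ (Fin m))}
  {f : ℝ → EuclideanSpace ℝ (Fin m) → EuclideanSpace ℝ (Fin m) → EuclideanSpace ℝ (Fin m)}
  {F : EuclideanSpace ℝ (Fin m) → ℝ} {x x' : ℝ → EuclideanSpace ℝ (Fin m)}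

/-- The first-order vector field on phase space associated with `ẍ = f(t, x, ẋ)`. -/
def phaseField
    (f : ℝ → EuclideanSpace ℝ (Fin m) → EuclideanSpace ℝ (Fin m) → EuclideanSpace ℝ (Fin m))
    (q : ℝ × EuclideanSpace ℝ (Fin m) × EuclideanSpace ℝ (Fin m)) :
    EuclideanSpace ℝ (Fin m) × EuclideanSpace ℝ (Fin m) :=
  (q.2.2, f q.1 q.2.1 q.2.2)

/-- The second derivative of `F` along solutions of `ẍ = f(t, x, ẋ)`. -/
def secondDerivAlong
    (f : ℝ → EuclideanSpace ℝ (Fin m) → EuclideanSpace ℝ (Fin m) → EuclideanSpace ℝ (Fin m))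
    (F : EuclideanSpace ℝ (Fin m) → ℝ)
    (q : ℝ × EuclideanSpace ℝ (Fin m) × EuclideanSpace ℝ (Fin m)) : ℝ :=
  fderiv ℝ F q.2.1 (f q.1 q.2.1 q.2.2) + fderiv ℝ (fderiv ℝ F) q.2.1 q.2.2 q.2.2

theorem IsSolOn.isTrajectory (hx : IsSolOn M f x x' (Ici 0)) :
    IsTrajectory (M ×ˢ univ) (phaseField f) (fun t => (x t, x' t)) :=
  fun t ht => ⟨⟨(hx t ht).1, mem_univ _⟩, (hx t ht).2.1.prodMk (hx t ht).2.2⟩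

theorem contDiffOn_phaseField {n : WithTop ℕ∞} (hf : ContDiffOn ℝ n
      (fun p : ℝ × EuclideanSpace ℝ (Fin m) × EuclideanSpace ℝ (Fin m) => f p.1 p.2.1 p.2.2)
      (Ici 0 ×ˢ M ×ˢ univ)) : ContDiffOn ℝ n (phaseField f) (Ici 0 ×ˢ M ×ˢ univ) :=
  (contDiff_snd.comp contDiff_snd).contDiffOn.prodMk hf

theorem continuousOn_secondDerivAlong (hM : IsOpen M) (hF : ContDiffOn ℝ 2 F M)
    (hf : ContinuousOn
      (fun p : ℝ × EuclideanSpace ℝ (Fin m) × EuclideanSpace ℝ (Fin m) => f p.1 p.2.1 p.2.2)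
      (Ici 0 ×ˢ M ×ˢ univ)) : ContinuousOn (secondDerivAlong f F) (Ici 0 ×ˢ M ×ˢ univ) := by
  have h1 : ContDiffOn ℝ 1 (fderiv ℝ F) M := hF.fderiv_of_isOpen hM (by norm_num)
  have h2 : ContDiffOn ℝ 0 (fderiv ℝ (fderiv ℝ F)) M := h1.fderiv_of_isOpen hM (by norm_num)
  have hmaps : MapsTo (fun q : ℝ × EuclideanSpace ℝ (Fin m) × EuclideanSpace ℝ (Fin m) => q.2.1)
      (Ici 0 ×ˢ M ×ˢ univ) M := fun q hq => hq.2.1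
  have hfst : ContinuousOn
      (fun q : ℝ × EuclideanSpace ℝ (Fin m) × EuclideanSpace ℝ (Fin m) => q.2.1)
      (Ici 0 ×ˢ M ×ˢ univ) := by fun_prop
  have hsnd : ContinuousOn
      (fun q : ℝ × EuclideanSpace ℝ (Fin m) × EuclideanSpace ℝ (Fin m) => q.2.2)
      (Ici 0 ×ˢ M ×ˢ univ) := by fun_prop
  exact ((h1.continuousOn.comp hfst hmaps).clm_apply hf).add
    (((h2.continuousOn.comp hfst hmaps).clm_apply hsnd).clm_apply hsnd)

theorem IsSolOn.hasDerivWithinAt_comp (hM : IsOpen M) (hF : ContDiffOn ℝ 2 F M)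
    (hx : IsSolOn M f x x' (Ici 0)) (t : ℝ) (ht : 0 ≤ t) :
    HasDerivWithinAt (fun s => F (x s)) (fderiv ℝ F (x t) (x' t)) (Ici 0) t :=
  ((hF.differentiableOn (by norm_num)).differentiableAt
    (hM.mem_nhds (hx t ht).1)).hasFDerivAt.comp_hasDerivWithinAt t (hx t ht).2.1

theorem IsSolOn.hasDerivWithinAt_fderiv (hM : IsOpen M) (hF : ContDiffOn ℝ 2 F M)
    (hx : IsSolOn M f x x' (Ici 0)) (t : ℝ) (ht : 0 ≤ t) :
    HasDerivWithinAt (fun s => fderiv ℝ F (x s) (x' s))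
      (secondDerivAlong f F (t, x t, x' t)) (Ici 0) t := by
  have h1 : ContDiffOn ℝ 1 (fderiv ℝ F) M := hF.fderiv_of_isOpen hM (by norm_num)
  have hd : HasDerivWithinAt (fun s => fderiv ℝ F (x s)) (fderiv ℝ (fderiv ℝ F) (x t) (x' t))
      (Ici 0) t :=
    ((h1.differentiableOn (by norm_num)).differentiableAt
      (hM.mem_nhds (hx t ht).1)).hasFDerivAt.comp_hasDerivWithinAt t (hx t ht).2.1
  rw [secondDerivAlong, add_comm]
  exact hd.clm_apply (hx t ht).2.2

/-- Solutions starting close to a boundary point, with velocity close to an outward or tangent one,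
are outside the sublevel set at some arbitrarily small time common to all of them. -/
theorem exists_forall_lt_of_initial_near_boundary (hM : IsOpen M) (hF : ContDiffOn ℝ 2 F M)
    (hf : ContinuousOn
      (fun p : ℝ × EuclideanSpace ℝ (Fin m) × EuclideanSpace ℝ (Fin m) => f p.1 p.2.1 p.2.2)
      (Ici 0 ×ˢ M ×ˢ univ)) {y w : EuclideanSpace ℝ (Fin m)} (hy : y ∈ M)
    (hw : 0 ≤ fderiv ℝ F y w)
    (htrans : fderiv ℝ F y w = 0 → 0 < secondDerivAlong f F (0, y, w)) {ε : ℝ} (hε : 0 < ε) :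
    ∃ s ∈ Ioo 0 ε, ∃ δ > 0, ∀ x x' : ℝ → EuclideanSpace ℝ (Fin m), IsSolOn M f x x' (Ici 0) →
      ‖(x 0, x' 0) - (y, w)‖ ≤ δ → F y < F (x s) := by
  have hV : ContinuousOn (phaseField f) (Ici 0 ×ˢ M ×ˢ univ) :=
    (continuous_snd.comp continuous_snd).continuousOn.prodMk hf
  have hyw : (y, w) ∈ M ×ˢ (univ : Set (EuclideanSpace ℝ (Fin m))) := ⟨hy, mem_univ _⟩
  have hFc : ContinuousAt F y := hF.continuousOn.continuousAt (hM.mem_nhds hy)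
  have hdc : ContinuousAt (fun q : EuclideanSpace ℝ (Fin m) × EuclideanSpace ℝ (Fin m) =>
      fderiv ℝ F q.1 q.2) (y, w) := by
    have h1 : ContDiffOn ℝ 1 (fderiv ℝ F) M := hF.fderiv_of_isOpen hM (by norm_num)
    exact ContinuousAt.clm_apply
      (ContinuousAt.comp (x := (y, w)) (h1.continuousOn.continuousAt (hM.mem_nhds hy))
        continuousAt_fst) continuousAt_snd
  -- It suffices to bound `F ∘ x` from below by a continuous function of the initial data.
  suffices H : ∃ s ∈ Ioo 0 ε, ∃ Φ : EuclideanSpace ℝ (Fin m) × EuclideanSpace ℝ (Fin m) → ℝ,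
      ContinuousAt Φ (y, w) ∧ F y < Φ (y, w) ∧ ∃ δ > 0,
      ∀ x x' : ℝ → EuclideanSpace ℝ (Fin m), IsSolOn M f x x' (Ici 0) →
      ‖(x 0, x' 0) - (y, w)‖ ≤ δ → Φ (x 0, x' 0) ≤ F (x s) by
    obtain ⟨s, hs, Φ, hΦ, hlt, δ, hδ, H⟩ := H
    obtain ⟨r, hr, hball⟩ := Metric.eventually_nhds_iff.1 (hΦ.eventually_const_lt hlt)
    refine ⟨s, hs, min δ (r / 2), by positivity, fun x x' hx h0 => ?_⟩
    refine (hball ?_).trans_le (H x x' hx (h0.trans (min_le_left _ _)))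
    rw [dist_eq_norm]
    have := h0.trans (min_le_right _ _)
    linarith
  have hF1 : ContinuousAt (fun q : EuclideanSpace ℝ (Fin m) × EuclideanSpace ℝ (Fin m) => F q.1)
      (y, w) := ContinuousAt.comp (x := (y, w)) hFc continuousAt_fst
  rcases hw.lt_or_eq with hpos | hzero
  · set a := fderiv ℝ F y w / 2 with ha
    have ha0 : 0 < a := by positivity
    obtain ⟨r, hr, hball⟩ := Metric.eventually_nhds_iff.1
      (hdc.eventually_const_lt (show a < fderiv ℝ F y w by linarith))
    obtain ⟨δ, hδ, η, hη, hstay⟩ := IsTrajectory.exists_forall_norm_sub_le_of_initial hV hyw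
      (half_pos hr)
    have hmin : 0 < min η (ε / 2) := by positivity
    refine ⟨min η (ε / 2), ⟨hmin, (min_le_right _ _).trans_lt (half_lt_self hε)⟩,
      fun q => F q.1 + a * min η (ε / 2), hF1.add continuousAt_const, ?_, δ, hδ,
      fun x x' hx h0 => ?_⟩
    · have := mul_pos ha0 hmin
      simpa using this
    · refine add_mul_le_of_deriv_ge (η := η) (hx.hasDerivWithinAt_comp hM hF) (fun t ht => ?_) _
        ⟨hmin.le, min_le_left _ _⟩
      refine (hball (y := (x t, x' t)) ?_).le
      rw [dist_eq_norm]
      have := hstay _ hx.isTrajectory h0 t ht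
      linarith
  · have hG := htrans hzero.symm
    set a := secondDerivAlong f F (0, y, w) / 2 with ha
    have ha0 : 0 < a := by positivity
    obtain ⟨r, hr, hball⟩ := Metric.mem_nhdsWithin_iff.1
      ((continuousOn_secondDerivAlong hM hF hf (0, y, w) ⟨self_mem_Ici, hyw⟩).eventually_const_lt
        (show a < secondDerivAlong f F (0, y, w) by linarith))
    obtain ⟨δ, hδ, η, hη, hstay⟩ := IsTrajectory.exists_forall_norm_sub_le_of_initial hV hyw
      (half_pos hr)
    set s := min (min η (r / 2)) (ε / 2) with hs
    have hmin : 0 < s := by positivity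
    refine ⟨s, ⟨hmin, (min_le_right _ _).trans_lt (half_lt_self hε)⟩,
      fun q => F q.1 + fderiv ℝ F q.1 q.2 * s + a / 2 * s ^ 2,
      (hF1.add (hdc.mul continuousAt_const)).add continuousAt_const, ?_, δ, hδ,
      fun x x' hx h0 => ?_⟩
    · have : 0 < a / 2 * s ^ 2 := by positivity
      simpa [← hzero] using this
    · refine add_mul_add_sq_le_of_second_deriv_ge (η := min η (r / 2))
        (hx.hasDerivWithinAt_comp hM hF) (hx.hasDerivWithinAt_fderiv hM hF) (fun t ht => ?_) _
        ⟨hmin.le, min_le_left _ _⟩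
      refine (show a < secondDerivAlong f F (t, x t, x' t) from hball ⟨?_, ht.1, (hx t ht.1).1, mem_univ _⟩).le
      rw [Metric.mem_ball, Prod.dist_eq, max_lt_iff]
      constructor
      · have : t ≤ r / 2 := ht.2.trans (min_le_right _ _)
        rw [Real.dist_eq, sub_zero, abs_of_nonneg ht.1]
        linarith
      · have := hstay _ hx.isTrajectory h0 t ⟨ht.1, ht.2.trans (min_le_left _ _)⟩
        change dist (x t, x' t) (y, w) < r
        rw [dist_eq_norm]
        linarith

end SecondOrder

/-- Lemma 3: the first exit time `τ(y)`, extended by `τ(y) = 0` on the boundary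
`∂D_c`, is continuous on the closure of `D_c`; in particular `τ(y) → 0` as
`y ∈ D_c` tends to a boundary point. -/
theorem exit_time_continuous_on_closure {m : ℕ} (M : Set (EuclideanSpace ℝ (Fin m)))
    (hMopen : IsOpen M) (hMconn : IsConnected M)
    (f : ℝ → EuclideanSpace ℝ (Fin m) → EuclideanSpace ℝ (Fin m) → EuclideanSpace ℝ (Fin m))
    (hf : ContDiffOn ℝ 2
      (fun p : ℝ × EuclideanSpace ℝ (Fin m) × EuclideanSpace ℝ (Fin m) => f p.1 p.2.1 p.2.2)
      (Ici 0 ×ˢ M ×ˢ univ))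
    (F : EuclideanSpace ℝ (Fin m) → ℝ) (hF : ContDiffOn ℝ 4 F M) (c : ℝ)
    (Dc bDc : Set (EuclideanSpace ℝ (Fin m)))
    (hDc : Dc = {x ∈ M | F x < c}) (hbDc : bDc = {x ∈ M | F x = c})
    (h2 : IsCompact (closure Dc)) (h2' : closure Dc ⊆ M)
    -- transversality condition on the boundary
    (h3 : ∀ t ∈ Ici (0:ℝ), ∀ x ∈ bDc, ∀ ξ : EuclideanSpace ℝ (Fin m),
      fderiv ℝ F x ξ = 0 →
      0 < fderiv ℝ F x (f t x ξ) + fderiv ℝ (fderiv ℝ F) x ξ ξ)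
    -- the continuous vector field of initial velocities
    (v : EuclideanSpace ℝ (Fin m) → EuclideanSpace ℝ (Fin m)) (hv : ContinuousOn v M)
    (hvF : ∀ x ∈ bDc, 0 ≤ fderiv ℝ F x (v x))
    -- the family of solutions `x(t, y)` with `x(0, y) = y`, `ẋ(0, y) = v(y)`
    (X X' : EuclideanSpace ℝ (Fin m) → ℝ → EuclideanSpace ℝ (Fin m))
    (hX : ∀ y ∈ Dc, IsSolOn M f (X y) (X' y) (Ici 0) ∧ X y 0 = y ∧ X' y 0 = v y)
    -- every solution leaves `D_c`; `τ y` is the first exit time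
    (τ : EuclideanSpace ℝ (Fin m) → ℝ)
    (hτ : ∀ y ∈ Dc, 0 < τ y ∧ F (X y (τ y)) = c ∧ ∀ t ∈ Ico (0:ℝ) (τ y), X y t ∈ Dc)
    (hτ0 : ∀ y ∈ bDc, τ y = 0) :
    ContinuousOn τ (closure Dc) ∧
      ∀ y₀ ∈ bDc, Filter.Tendsto τ (nhdsWithin y₀ Dc) (nhds 0) := by
  subst hDc hbDc
  have hF2 : ContDiffOn ℝ 2 F M := hF.of_le (by norm_num)
  have hopen : IsOpen {x ∈ M | F x < c} := hF.continuousOn.isOpen_inter_preimage hMopen isOpen_Iio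
  have hopen' : IsOpen {x ∈ M | c < F x} := hF.continuousOn.isOpen_inter_preimage hMopen isOpen_Ioi
  have hclosure : closure {x ∈ M | F x < c} ⊆ {x ∈ M | F x < c} ∪ {x ∈ M | F x = c} := by
    intro y hy
    have hyM := h2' hy
    have hle : F y ≤ c := by
      by_contra! hlt
      obtain ⟨z, hz, hz'⟩ := mem_closure_iff.1 hy _ hopen' ⟨hyM, hlt⟩
      exact lt_asymm hz.2 hz'.2
    rcases hle.lt_or_eq with h | h
    · exact Or.inl ⟨hyM, h⟩
    · exact Or.inr ⟨hyM, h⟩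
  have hinit : ∀ y ∈ M, ContinuousAt (fun z => (z, v z)) y := fun y hy =>
    continuousAt_id.prodMk (hv.continuousAt (hMopen.mem_nhds hy))
  have hnear : ∀ y ∈ M, ∀ δ > 0, ∀ᶠ z in nhds y, ‖(z, v z) - (y, v y)‖ ≤ δ := by
    intro y hy δ hδ
    filter_upwards [(hinit y hy).eventually (Metric.closedBall_mem_nhds _ hδ)] with z hz
    rwa [← dist_eq_norm]
  have hle_of_lt : ∀ y ∈ {x ∈ M | F x < c}, ∀ s, 0 ≤ s → c < F (X y s) → τ y ≤ s := by
    intro y hy s hs hlt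
    by_contra! h
    exact lt_asymm hlt ((hτ y hy).2.2 s ⟨hs, h⟩).2
  have hboundary : ∀ y₀ ∈ {x ∈ M | F x = c},
      Filter.Tendsto τ (nhdsWithin y₀ {x ∈ M | F x < c}) (nhds 0) := by
    intro y₀ hy₀
    rw [Metric.tendsto_nhds]
    intro ε hε
    obtain ⟨s, hs, δ, hδ, H⟩ := exists_forall_lt_of_initial_near_boundary hMopen hF2
      hf.continuousOn hy₀.1 (hvF y₀ hy₀) (h3 0 self_mem_Ici y₀ hy₀ (v y₀)) hε
    filter_upwards [self_mem_nhdsWithin,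
      (hnear y₀ hy₀.1 δ hδ).filter_mono nhdsWithin_le_nhds] with y hy hyδ
    obtain ⟨hsol, h0, h0'⟩ := hX y hy
    have hlt := H (X y) (X' y) hsol (by rwa [h0, h0'])
    rw [hy₀.2] at hlt
    rw [Real.dist_eq, sub_zero, abs_of_pos (hτ y hy).1]
    exact (hle_of_lt y hy s hs.1.le hlt).trans_lt hs.2
  refine ⟨fun y₀ hy₀ => ?_, hboundary⟩
  rcases hclosure hy₀ with hy | hy
  · refine ContinuousAt.continuousWithinAt (Metric.tendsto_nhds.2 fun ε hε => ?_)
    obtain ⟨hsol, h0, h0'⟩ := hX y₀ hy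
    obtain ⟨hτpos, hτc, hτlt⟩ := hτ y₀ hy
    have hderiv := hsol.hasDerivWithinAt_comp hMopen hF2
    have hpos := deriv_pos_of_first_hit hτpos hderiv
      (hsol.hasDerivWithinAt_fderiv hMopen hF2 _ hτpos.le) (fun t ht => (hτlt t ht).2) hτc
      (h3 _ hτpos.le _ ⟨(hsol _ hτpos.le).1, hτc⟩ _)
    obtain ⟨t₁, ht₁, hgt⟩ := exists_gt_of_hasDerivAt_pos
      ((hderiv _ hτpos.le).hasDerivAt (Ici_mem_nhds hτpos)) hpos hε
    rw [hτc] at hgt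
    have ht₁0 : 0 < t₁ := hτpos.trans ht₁.1
    obtain ⟨ρ₁, hρ₁, hball₁⟩ := Metric.isOpen_iff.1 hopen' _ ⟨(hsol t₁ ht₁0.le).1, hgt⟩
    have hcomp : IsCompact (X y₀ '' Icc 0 (τ y₀ - ε / 2)) :=
      isCompact_Icc.image_of_continuousOn
        fun t ht => (hsol t ht.1).2.1.continuousWithinAt.mono Icc_subset_Ici_self
    obtain ⟨ρ₂, hρ₂, hball₂⟩ := hcomp.exists_cthickening_subset_open hopen (by
      rintro _ ⟨t, ht, rfl⟩
      exact hτlt t ⟨ht.1, by linarith [ht.2]⟩)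
    obtain ⟨δ, hδ, H⟩ := hsol.isTrajectory.exists_forall_norm_sub_le (hMopen.prod isOpen_univ)
      (ContDiffOn.locallyLipschitzOn_Ici_prod (hMopen.prod isOpen_univ)
        (contDiffOn_phaseField (hf.of_le (by norm_num)))) t₁
      (show 0 < min (ρ₁ / 2) ρ₂ by positivity)
    filter_upwards [hopen.mem_nhds hy, hnear y₀ hy.1 δ hδ] with y hyD hyδ
    obtain ⟨hsol', k0, k0'⟩ := hX y hyD
    have hclose : ∀ t ∈ Icc 0 t₁, ‖X y t - X y₀ t‖ ≤ min (ρ₁ / 2) ρ₂ := fun t ht =>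
      (norm_fst_le _).trans (H _ hsol'.isTrajectory (by simpa only [h0, h0', k0, k0']) t ht)
    have hupper : τ y ≤ t₁ := by
      refine hle_of_lt y hyD t₁ ht₁0.le (hball₁ ?_).2
      rw [mem_ball_iff_norm]
      have := (hclose t₁ (right_mem_Icc.2 ht₁0.le)).trans (min_le_left _ _)
      linarith
    have hlower : τ y₀ - ε / 2 < τ y := by
      by_contra! hle
      have hmem : X y (τ y) ∈ {x ∈ M | F x < c} := by
        refine hball₂ (Metric.closedBall_subset_cthickening
          (mem_image_of_mem (X y₀) (mem_Icc.2 ⟨(hτ y hyD).1.le, hle⟩)) ρ₂ ?_)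
        rw [mem_closedBall_iff_norm]
        exact (hclose _ ⟨(hτ y hyD).1.le, hupper⟩).trans (min_le_right _ _)
      exact hmem.2.ne (hτ y hyD).2.1
    rw [Real.dist_eq, abs_lt]
    constructor <;> linarith [ht₁.2]
  · refine ContinuousWithinAt.mono ?_ hclosure
    refine ContinuousWithinAt.union ?_ ?_
    · rw [ContinuousWithinAt, hτ0 y₀ hy]
      exact hboundary y₀ hy
    · exact continuousWithinAt_const.congr hτ0 (hτ0 y₀ hy)
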